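/- Let d ∈ N, let w : Z^d → (0,∞) be a weight, and set σ_n := a_n(I_d : F_d(w) → L₂(T^d)). Suppose there are α > 1/2, β ≥ 0, constants 0 < A ≤ B < ∞ and N ∈ N such that A · n^{−α} (ln n)^β ≤ σ_n ≤ B · n^{−α} (ln n)^β for all n ≥ N. Then: (i) a_{n+1}(I_d : F_d(w) → L∞(T^d)) ≤ B · √(2/(2α−1)) · n^{1/2−α} (ln n)^β for all n ≥ max(N, e^{4β/(2α−1)}); and (ii) a_n(I_d : F_d(w) → L∞(T^d)) ≥ A · √(1/(4α−2)) · n^{1/2−α} (ln n)^β for all n ≥ max(N, 2). -/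

import Mathlib

open MeasureTheory Filter
open scoped ENNReal NNReal

noncomputable section

/-- The index lattice `ℤ^d`. -/
abbrev ZLat (d : ℕ) := Fin d → ℤ

instance fact_two_pi_pos : Fact (0 < 2 * Real.pi) := ⟨by positivity⟩

/-- The `d`-dimensional torus `𝕋^d = [0,2π]^d` with endpoints identified. -/
abbrev Torus (d : ℕ) := Fin d → AddCircle (2 * Real.pi)

/-- The normalized Lebesgue measure `(2π)^{-d} dx` on the `d`-torus. -/
def torusMeasure (d : ℕ) : Measure (Torus d) :=
  ((ENNReal.ofReal (2 * Real.pi))⁻¹) ^ d • Measure.pi fun _ => volume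

/-- The character `e^{i k·x}` on the `d`-torus. -/
def torusChar {d : ℕ} (k : ZLat d) (x : Torus d) : ℂ :=
  ∏ j, fourier (k j) (x j)

/-- The `k`-th Fourier coefficient `f̂(k) = (2π)^{-d} ∫_{𝕋^d} f(x) e^{-i k·x} dx`. -/
def fourierCoef {d : ℕ} (f : Torus d → ℂ) (k : ZLat d) : ℂ :=
  ∫ x, (starRingEnd ℂ) (torusChar k x) * f x ∂(torusMeasure d)

/-- The `n`-th approximation number of a bounded linear operator `T`:
`a_n(T) = inf {‖T - A‖ : rank A < n}`. -/
def approxNum {X Y : Type*} [NormedAddCommGroup X] [NormedSpace ℂ X]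
    [NormedAddCommGroup Y] [NormedSpace ℂ Y] (T : X →L[ℂ] Y) (n : ℕ) : ℝ :=
  sInf {c : ℝ | ∃ A : X →L[ℂ] Y,
    Module.rank ℂ (LinearMap.range (A : X →ₗ[ℂ] Y)) < n ∧ c = ‖T - A‖}

/-- `ℓ²(ℤ^d)`; an isometric model of the Hilbert space `F_d(w)` via `f ↦ (w(k)·f̂(k))_k`.
Under this identification the embedding `I_d : F_d(w) → G` is characterized by the
property that the function `T c` has Fourier coefficients `c(k)/w(k)`. -/
abbrev ellTwo (d : ℕ) := lp (fun _ : ZLat d => ℂ) 2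

/-- `ℓ¹(ℤ^d)`; an isometric model of the Wiener algebra `A(𝕋^d)` via `f ↦ (f̂(k))_k`. -/
abbrev ellOne (d : ℕ) := lp (fun _ : ZLat d => ℂ) 1

/-- `ℓ^∞(ℤ^d)`; an isometric model of the space `ℬ(𝕋^d)` of distributions with bounded
Fourier coefficients. -/
abbrev ellInfty (d : ℕ) := lp (fun _ : ZLat d => ℂ) ⊤

/-! ### The Fourier basis of `L²` of the torus -/

instance isProbabilityMeasure_torusMeasure (d : ℕ) : IsProbabilityMeasure (torusMeasure d) := by
  constructor
  have h : ENNReal.ofReal (2 * Real.pi) ≠ 0 := by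
    simpa using Real.pi_pos
  rw [torusMeasure, Measure.smul_apply, Measure.pi_univ]
  simp only [AddCircle.measure_univ, Finset.prod_const, Finset.card_univ, Fintype.card_fin,
    smul_eq_mul]
  rw [← mul_pow, ENNReal.inv_mul_cancel h ENNReal.ofReal_ne_top, one_pow]

/-- The character `e^{i k·x}` as a continuous function on the torus. -/
def torusCharC {d : ℕ} (k : ZLat d) : C(Torus d, ℂ) where
  toFun := torusChar k
  continuous_toFun := by unfold torusChar; fun_prop

lemma torusCharC_apply {d : ℕ} (k : ZLat d) (x : Torus d) :
    torusCharC k x = ∏ j, fourier (k j) (x j) := rfl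

lemma torusCharC_neg {d : ℕ} (k : ZLat d) (x : Torus d) :
    torusCharC (-k) x = (starRingEnd ℂ) (torusCharC k x) := by
  simp only [torusCharC_apply, Pi.neg_apply, fourier_neg, map_prod]

lemma torusCharC_add {d : ℕ} (k l : ZLat d) (x : Torus d) :
    torusCharC (k + l) x = torusCharC k x * torusCharC l x := by
  simp only [torusCharC_apply, Pi.add_apply, fourier_add, ← Finset.prod_mul_distrib]

lemma norm_torusCharC_apply {d : ℕ} (k : ZLat d) (x : Torus d) : ‖torusCharC k x‖ = 1 := by
  simp only [torusCharC_apply, fourier_apply, norm_prod, Circle.norm_coe, Finset.prod_const_one]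

lemma norm_torusCharC_le {d : ℕ} (k : ZLat d) : ‖torusCharC k‖ ≤ 1 :=
  (ContinuousMap.norm_le _ zero_le_one).mpr fun x => (norm_torusCharC_apply k x).le

lemma torusCharC_single {d : ℕ} (i : Fin d) (x : Torus d) :
    torusCharC (Pi.single i 1) x = fourier 1 (x i) := by
  rw [torusCharC_apply, Finset.prod_eq_single i]
  · rw [Pi.single_eq_same]
  · intro j _ hj
    rw [Pi.single_eq_of_ne hj, fourier_zero]
  · simp

/-- The star subalgebra of `C(𝕋^d, ℂ)` generated by the characters. -/
def torusCharSubalgebra (d : ℕ) : StarSubalgebra ℂ C(Torus d, ℂ) where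
  toSubalgebra := Algebra.adjoin ℂ (Set.range torusCharC)
  star_mem' := by
    change Algebra.adjoin ℂ (Set.range torusCharC) ≤ star (Algebra.adjoin ℂ (Set.range torusCharC))
    refine Algebra.adjoin_le ?_
    rintro _ ⟨n, rfl⟩
    refine Algebra.subset_adjoin ⟨-n, ?_⟩
    ext1 x
    simp only [torusCharC_neg, starRingEnd_apply, ContinuousMap.star_apply]

lemma torusCharSubalgebra_toSubmodule (d : ℕ) :
    (torusCharSubalgebra d).toSubalgebra.toSubmodule =
      Submodule.span ℂ (Set.range (torusCharC (d := d))) := by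
  apply Algebra.adjoin_eq_span_of_subset
  refine .trans (fun x ↦ Submonoid.closure_induction (fun _ ↦ id) ⟨0, ?_⟩ ?_) Submodule.subset_span
  · ext z
    simp [torusCharC_apply]
  · rintro _ _ _ _ ⟨m, rfl⟩ ⟨n, rfl⟩
    refine ⟨m + n, ?_⟩
    ext z
    simp only [torusCharC_add, ContinuousMap.mul_apply]

lemma torusCharSubalgebra_separatesPoints (d : ℕ) :
    (torusCharSubalgebra d).SeparatesPoints := by
  intro x y hxy
  rw [Ne, funext_iff, not_forall] at hxy
  obtain ⟨i, hi⟩ := hxy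
  refine ⟨_, ⟨torusCharC (Pi.single i 1), Algebra.subset_adjoin ⟨Pi.single i 1, rfl⟩, rfl⟩, ?_⟩
  dsimp only
  rw [torusCharC_single, torusCharC_single, fourier_one, fourier_one]
  contrapose hi
  exact AddCircle.injective_toCircle (by positivity) (Circle.coe_injective hi)

lemma span_torusCharC_closure_eq_top (d : ℕ) :
    (Submodule.span ℂ (Set.range (torusCharC (d := d)))).topologicalClosure = ⊤ := by
  rw [← torusCharSubalgebra_toSubmodule]
  exact congr_arg (Subalgebra.toSubmodule <| StarSubalgebra.toSubalgebra ·)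
    (ContinuousMap.starSubalgebra_topologicalClosure_eq_top_of_separatesPoints _
      (torusCharSubalgebra_separatesPoints d))

/-- The character `e^{i k·x}` as an element of `L²(𝕋^d)`. -/
def torusCharLp {d : ℕ} (k : ZLat d) : Lp ℂ 2 (torusMeasure d) :=
  ContinuousMap.toLp 2 (torusMeasure d) ℂ (torusCharC k)

lemma inner_torusCharLp {d : ℕ} (k : ZLat d) (f : Lp ℂ 2 (torusMeasure d)) :
    inner ℂ (torusCharLp k) f = fourierCoef (⇑f) k := by
  rw [L2.inner_def, fourierCoef]
  refine integral_congr_ae ?_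
  filter_upwards [ContinuousMap.coeFn_toLp (p := 2) (𝕜 := ℂ) (torusMeasure d) (torusCharC k)]
    with x hx
  rw [torusCharLp, hx, RCLike.inner_apply']
  rfl

lemma integral_torusCharC {d : ℕ} (k : ZLat d) (hk : k ≠ 0) :
    ∫ x, torusCharC k x ∂(torusMeasure d) = 0 := by
  simp only [torusMeasure, torusCharC_apply, integral_smul_measure]
  rw [integral_fintype_prod_eq_prod (𝕜 := ℂ) (fun j (x : AddCircle (2 * Real.pi)) => fourier (k j) x)]
  obtain ⟨j, hj⟩ := Function.ne_iff.mp hk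
  rw [Finset.prod_eq_zero (Finset.mem_univ j), smul_zero]
  exact integral_eq_zero_of_add_right_eq_neg (fourier_add_half_inv_index hj (by positivity))

lemma orthonormal_torusCharLp (d : ℕ) : Orthonormal ℂ (torusCharLp (d := d)) := by
  rw [orthonormal_iff_ite]
  intro k l
  rw [torusCharLp, torusCharLp, ContinuousMap.inner_toLp]
  simp_rw [mul_comm (torusCharC l _), ← torusCharC_neg, ← torusCharC_add]
  split_ifs with h
  · subst h
    simp [torusCharC_apply]
  · refine integral_torusCharC _ fun h0 => h ?_
    rwa [neg_add_eq_zero] at h0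

lemma span_torusCharLp_closure_eq_top (d : ℕ) :
    (Submodule.span ℂ (Set.range (torusCharLp (d := d)))).topologicalClosure = ⊤ := by
  have h := (ContinuousMap.toLp_denseRange ℂ (torusMeasure d) ℂ
    (p := 2) (by norm_num)).topologicalClosure_map_submodule (span_torusCharC_closure_eq_top d)
  erw [Submodule.map_span] at h
  rw [← Set.range_comp] at h
  exact h

/-- The orthonormal basis of `L²(𝕋^d)` given by the characters. -/
def torusBasis (d : ℕ) : HilbertBasis (ZLat d) ℂ (Lp ℂ 2 (torusMeasure d)) :=
  HilbertBasis.mk (orthonormal_torusCharLp d) (span_torusCharLp_closure_eq_top d).ge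

lemma torusBasis_apply {d : ℕ} (k : ZLat d) : torusBasis d k = torusCharLp k := by
  rw [torusBasis, HilbertBasis.coe_mk]

lemma torusBasis_repr_apply {d : ℕ} (f : Lp ℂ 2 (torusMeasure d)) (k : ZLat d) :
    (torusBasis d).repr f k = fourierCoef (⇑f) k := by
  rw [HilbertBasis.repr_apply_apply, torusBasis_apply, inner_torusCharLp]

lemma fourierCoef_congr_ae {d : ℕ} {f g : Torus d → ℂ} (h : f =ᵐ[torusMeasure d] g)
    (k : ZLat d) : fourierCoef f k = fourierCoef g k :=
  integral_congr_ae (h.mono fun x hx => by simp only [hx])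

lemma ae_eq_of_fourierCoef_eq {d : ℕ} {f g : Torus d → ℂ} (hf : MemLp f 2 (torusMeasure d))
    (hg : MemLp g 2 (torusMeasure d)) (h : ∀ k, fourierCoef f k = fourierCoef g k) :
    f =ᵐ[torusMeasure d] g := by
  have key : hf.toLp f = hg.toLp g := by
    apply (torusBasis d).repr.injective
    ext k
    rw [torusBasis_repr_apply, torusBasis_repr_apply, fourierCoef_congr_ae hf.coeFn_toLp,
      fourierCoef_congr_ae hg.coeFn_toLp, h]
  exact (MemLp.toLp_eq_toLp_iff hf hg).mp key

/-- A square integrable function with absolutely summable Fourier coefficients is essentially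
bounded by the sum of their absolute values. -/
lemma ae_norm_le_of_sum_fourierCoef_le {d : ℕ} {f : Torus d → ℂ}
    (hf : MemLp f 2 (torusMeasure d)) {M : ℝ}
    (hM : ∀ F : Finset (ZLat d), ∑ k ∈ F, ‖fourierCoef f k‖ ≤ M) :
    ∀ᵐ x ∂(torusMeasure d), ‖f x‖ ≤ M := by
  have hs : Summable fun k => ‖fourierCoef f k‖ :=
    summable_of_sum_le (fun _ => norm_nonneg _) hM
  have hle : ∀ k, ‖fourierCoef f k • torusCharC k‖ ≤ ‖fourierCoef f k‖ := fun k => by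
    rw [norm_smul]
    exact mul_le_of_le_one_right (norm_nonneg _) (norm_torusCharC_le k)
  have hG : Summable fun k => fourierCoef f k • torusCharC k :=
    Summable.of_norm_bounded hs hle
  set G : C(Torus d, ℂ) := ∑' k, fourierCoef f k • torusCharC k with hGdef
  have hGnorm : ‖G‖ ≤ M :=
    (tsum_of_norm_bounded hs.hasSum hle).trans (hs.tsum_le_of_sum_le hM)
  have h1 : HasSum (fun k => fourierCoef f k • torusCharLp k)
      (ContinuousMap.toLp 2 (torusMeasure d) ℂ G) := by
    have := hG.hasSum.mapL (ContinuousMap.toLp 2 (torusMeasure d) ℂ)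
    simpa only [map_smul, ← hGdef] using! this
  have h2 : HasSum (fun k => fourierCoef f k • torusCharLp k) (hf.toLp f) := by
    have := (torusBasis d).hasSum_repr (hf.toLp f)
    simpa only [torusBasis_repr_apply, torusBasis_apply,
      fourierCoef_congr_ae hf.coeFn_toLp] using this
  have h3 := h1.unique h2
  filter_upwards [hf.coeFn_toLp, ContinuousMap.coeFn_toLp (p := 2) (𝕜 := ℂ) (torusMeasure d) G]
    with x hx hx'
  rw [← hx, ← h3, hx']
  exact (G.norm_coe_le_norm x).trans hGnorm

/-! ### Approximation numbers -/

lemma approxNum_le {X Y : Type*} [NormedAddCommGroup X] [NormedSpace ℂ X]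
    [NormedAddCommGroup Y] [NormedSpace ℂ Y] (T A : X →L[ℂ] Y) {n : ℕ}
    (hA : Module.rank ℂ (LinearMap.range (A : X →ₗ[ℂ] Y)) < n) :
    approxNum T n ≤ ‖T - A‖ :=
  csInf_le ⟨0, by rintro _ ⟨A, -, rfl⟩; exact norm_nonneg _⟩ ⟨A, hA, rfl⟩

lemma le_approxNum {X Y : Type*} [NormedAddCommGroup X] [NormedSpace ℂ X]
    [NormedAddCommGroup Y] [NormedSpace ℂ Y] (T : X →L[ℂ] Y) {n : ℕ} (hn : 0 < n) {c : ℝ}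
    (h : ∀ A : X →L[ℂ] Y, Module.rank ℂ (LinearMap.range (A : X →ₗ[ℂ] Y)) < n → c ≤ ‖T - A‖) :
    c ≤ approxNum T n := by
  refine le_csInf ⟨_, 0, ?_, rfl⟩ ?_
  · simpa [LinearMap.range_zero] using hn
  · rintro _ ⟨A, hA, rfl⟩
    exact h A hA

/-- If `θ < a_n(T)`, then the kernel of any operator into a space of dimension less than `n`
contains a unit vector `f` with `‖T f‖ ≥ θ`. -/
lemma exists_unit_mem_ker_of_lt_approxNum {H Y Z : Type} [NormedAddCommGroup H]
    [InnerProductSpace ℂ H] [CompleteSpace H] [NormedAddCommGroup Y] [NormedSpace ℂ Y]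
    [NormedAddCommGroup Z] [NormedSpace ℂ Z] (T : H →L[ℂ] Y) (G : H →L[ℂ] Z) {n : ℕ}
    (hZ : Module.rank ℂ Z < n) {θ : ℝ} (hθ : 0 ≤ θ) (hθn : θ < approxNum T n) :
    ∃ f, ‖f‖ = 1 ∧ G f = 0 ∧ θ ≤ ‖T f‖ := by
  obtain ⟨f, hf0, hf⟩ : ∃ f, G f = 0 ∧ θ * ‖f‖ < ‖T f‖ := by
    by_contra! hcon
    set V : Submodule ℂ H := LinearMap.ker (G : H →ₗ[ℂ] Z) with hV
    have hVc : IsClosed (V : Set H) := G.isClosed_ker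
    have : CompleteSpace V := hVc.completeSpace_coe
    have hrank : Module.rank ℂ (LinearMap.range ((T ∘L Vᗮ.starProjection : H →L[ℂ] Y) :
        H →ₗ[ℂ] Y)) < n := by
      refine lt_of_le_of_lt ?_ hZ
      have h1 : Module.rank ℂ Vᗮ ≤ Module.rank ℂ Z := by
        refine LinearMap.rank_le_of_injective ((G : H →ₗ[ℂ] Z) ∘ₗ Vᗮ.subtype) ?_
        rw [← LinearMap.ker_eq_bot, LinearMap.ker_eq_bot']
        intro x hx
        have hxV : (x : H) ∈ V := hx
        have := V.inner_right_of_mem_orthogonal hxV x.2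
        exact Subtype.ext (inner_self_eq_zero.mp this)
      refine le_trans ?_ h1
      have h2 : ((T ∘L Vᗮ.starProjection : H →L[ℂ] Y) : H →ₗ[ℂ] Y) =
          ((T : H →ₗ[ℂ] Y) ∘ₗ Vᗮ.subtype) ∘ₗ (Vᗮ.orthogonalProjectionOnto : H →ₗ[ℂ] Vᗮ) := by
        ext x
        rfl
      rw [h2]
      exact (LinearMap.rank_comp_le_left _ _).trans (LinearMap.rank_le_domain _)
    refine hθn.not_ge ((approxNum_le T _ hrank).trans ?_)
    refine ContinuousLinearMap.opNorm_le_bound _ hθ fun x => ?_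
    have hx : x = V.starProjection x + Vᗮ.starProjection x := by
      simp
    have hTx : (T - T ∘L Vᗮ.starProjection) x = T (V.starProjection x) := by
      rw [sub_apply, ContinuousLinearMap.comp_apply, ← map_sub]
      congr 1
      nth_rewrite 1 [hx]
      abel
    rw [hTx]
    have hmem : V.starProjection x ∈ V := V.starProjection_apply_mem x
    exact (hcon _ hmem).trans (mul_le_mul_of_nonneg_left (V.norm_starProjection_apply_le x) hθ)
  have hf1 : 0 < ‖f‖ := by
    refine norm_pos_iff.mpr fun h => ?_
    simp [h] at hf
  refine ⟨((‖f‖⁻¹ : ℝ) : ℂ) • f, ?_, ?_, ?_⟩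
  · rw [norm_smul, Complex.norm_real, norm_inv, norm_norm, inv_mul_cancel₀ hf1.ne']
  · rw [map_smul, hf0, smul_zero]
  · rw [map_smul, norm_smul, Complex.norm_real, norm_inv, norm_norm, inv_mul_eq_div,
      le_div_iff₀ hf1]
    exact hf.le

/-- The kernel of an operator of rank less than `n` contains orthonormal vectors
`f₀, …, f_{p-1}` such that `‖T fᵢ‖` is at least any prescribed number below `a_{n+i}(T)`. -/
lemma exists_orthonormal_mem_ker {H Y Z : Type} [NormedAddCommGroup H]
    [InnerProductSpace ℂ H] [CompleteSpace H] [NormedAddCommGroup Y] [NormedSpace ℂ Y]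
    [NormedAddCommGroup Z] [NormedSpace ℂ Z] (T : H →L[ℂ] Y) (A : H →L[ℂ] Z) {n : ℕ}
    (hA : Module.rank ℂ (LinearMap.range (A : H →ₗ[ℂ] Z)) < n) {θ : ℕ → ℝ} (hθ : ∀ i, 0 ≤ θ i)
    (hθn : ∀ i, θ i < approxNum T (n + i)) (p : ℕ) :
    ∃ f : Fin p → H, Orthonormal ℂ f ∧ ∀ i, A (f i) = 0 ∧ θ i ≤ ‖T (f i)‖ := by
  induction p with
  | zero => exact ⟨Fin.elim0, ⟨fun i => i.elim0, fun i => i.elim0⟩, fun i => i.elim0⟩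
  | succ p ih =>
    obtain ⟨f, hfo, hf⟩ := ih
    let G : H →L[ℂ] LinearMap.range (A : H →ₗ[ℂ] Z) × (Fin p → ℂ) :=
      A.rangeRestrict.prod (ContinuousLinearMap.pi fun i => innerSL ℂ (f i))
    have hrank : Module.rank ℂ (LinearMap.range (A : H →ₗ[ℂ] Z) × (Fin p → ℂ)) < (n + p : ℕ) := by
      obtain ⟨m, hm⟩ := Cardinal.lt_aleph0.mp (hA.trans (Cardinal.natCast_lt_aleph0))
      rw [hm, Nat.cast_lt] at hA
      rw [rank_prod', rank_fin_fun, hm]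
      exact_mod_cast Nat.add_lt_add_right hA p
    obtain ⟨g, hg1, hg0, hgT⟩ :=
      exists_unit_mem_ker_of_lt_approxNum T G hrank (hθ p) (hθn p)
    have hgA : A g = 0 := congrArg (fun z => (z.1 : Z)) hg0
    have hgf : ∀ i, inner ℂ (f i) g = 0 := fun i => congrArg (fun z => z.2 i) hg0
    refine ⟨Fin.snoc f g, ?_, ?_⟩
    · rw [orthonormal_iff_ite] at hfo ⊢
      intro i j
      refine Fin.lastCases ?_ (fun i => ?_) i <;> refine Fin.lastCases ?_ (fun j => ?_) j
      · simp [inner_self_eq_norm_sq_to_K, hg1]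
      · have := inner_eq_zero_symm.mp (hgf j)
        simp [this, (Fin.castSucc_lt_last j).ne']
      · simp [hgf i, (Fin.castSucc_lt_last i).ne]
      · simp [hfo i j]
    · intro i
      refine Fin.lastCases ?_ (fun i => ?_) i
      · simpa using ⟨hgA, hgT⟩
      · simpa using hf i

/-- An orthonormal system is mapped by a bounded operator into `L∞` to functions whose squares
sum up to at most the square of the operator norm. -/
lemma ae_sum_sq_le_of_orthonormal {H Ω : Type*} [NormedAddCommGroup H] [InnerProductSpace ℂ H]
    [MeasurableSpace Ω] {μ : Measure Ω} (S : H →L[ℂ] Lp ℂ ⊤ μ) {p : ℕ} {f : Fin p → H}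
    (hf : Orthonormal ℂ f) :
    ∀ᵐ x ∂μ, ∑ i, ‖S (f i) x‖ ^ 2 ≤ ‖S‖ ^ 2 := by
  have h1 : ∀ a : EuclideanSpace ℂ (Fin p),
      ∀ᵐ x ∂μ, ‖∑ i, a i * S (f i) x‖ ≤ ‖S‖ * ‖a‖ := by
    intro a
    have hnorm : ‖∑ i, a i • f i‖ = ‖a‖ := by
      rw [EuclideanSpace.norm_eq, ← Real.sqrt_sq (norm_nonneg (∑ i, a i • f i))]
      congr 1
      have := hf.inner_sum a a Finset.univ
      rw [inner_self_eq_norm_sq_to_K] at this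
      simp only [RCLike.conj_mul] at this
      exact_mod_cast this
    have hle := S.le_opNorm (∑ i, a i • f i)
    rw [hnorm] at hle
    have hb : ∀ᵐ x ∂μ, ‖S (∑ i, a i • f i) x‖ ≤ ‖S (∑ i, a i • f i)‖ := by
      filter_upwards [ae_le_eLpNormEssSup (f := ⇑(S (∑ i, a i • f i))) (μ := μ)] with x hx
      rw [← eLpNorm_exponent_top, ← Lp.enorm_def] at hx
      exact enorm_le_iff_norm_le.mp hx
    have hsum : ⇑(S (∑ i, a i • f i)) =ᵐ[μ] fun x => ∑ i, a i * S (f i) x := by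
      rw [map_sum]
      refine (Lp.coeFn_finsetSum _ _).trans ?_
      have : ∀ᵐ x ∂μ, ∀ i, (S (a i • f i)) x = a i * S (f i) x := by
        rw [ae_all_iff]
        intro i
        rw [map_smul]
        exact (Lp.coeFn_smul _ _).mono fun x hx => hx
      filter_upwards [this] with x hx
      rw [Finset.sum_apply]
      exact Finset.sum_congr rfl fun i _ => hx i
    filter_upwards [hb, hsum] with x hx hx'
    rw [← hx']
    exact hx.trans hle
  have h2 : ∀ᵐ x ∂μ, ∀ m : ℕ, ‖∑ i, TopologicalSpace.denseSeq (EuclideanSpace ℂ (Fin p)) m i *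
      S (f i) x‖ ≤ ‖S‖ * ‖TopologicalSpace.denseSeq (EuclideanSpace ℂ (Fin p)) m‖ :=
    ae_all_iff.mpr fun m => h1 _
  filter_upwards [h2] with x hx
  have h3 : ∀ a : EuclideanSpace ℂ (Fin p), ‖∑ i, a i * S (f i) x‖ ≤ ‖S‖ * ‖a‖ := by
    intro a
    refine (TopologicalSpace.denseRange_denseSeq _).induction_on a ?_ hx
    exact isClosed_le (by fun_prop) (by fun_prop)
  have h4 := h3 (WithLp.toLp 2 fun i => (starRingEnd ℂ) (S (f i) x))
  simp only [Complex.conj_mul'] at h4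
  set Q := ∑ i, ‖S (f i) x‖ ^ 2 with hQ
  have hQ0 : 0 ≤ Q := Finset.sum_nonneg fun i _ => sq_nonneg _
  have h5 : Q ≤ ‖S‖ * Real.sqrt Q := by
    convert h4 using 1
    · have : (∑ i, (‖S (f i) x‖ : ℂ) ^ 2) = (Q : ℂ) := by rw [hQ]; push_cast; rfl
      rw [this, Complex.norm_real, Real.norm_of_nonneg hQ0]
    · rw [EuclideanSpace.norm_eq]
      simp [hQ]
  rcases hQ0.eq_or_lt with h0 | h0
  · rw [← h0]; positivity
  · have hs : 0 < Real.sqrt Q := Real.sqrt_pos.mpr h0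
    have h6 : Real.sqrt Q ≤ ‖S‖ := by
      nlinarith [Real.mul_self_sqrt hQ0]
    nlinarith [Real.mul_self_sqrt hQ0]

/-! ### Power sums -/

lemma rpow_neg_sub_rpow_neg_bounds {p x : ℝ} (hp : 0 < p) (hx : 0 < x) :
    p * (x + 1) ^ (-(p + 1)) ≤ x ^ (-p) - (x + 1) ^ (-p) ∧
      x ^ (-p) - (x + 1) ^ (-p) ≤ p * x ^ (-(p + 1)) := by
  obtain ⟨c, ⟨hc1, hc2⟩, hc⟩ := exists_hasDerivAt_eq_slope (fun y : ℝ => y ^ (-p))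
    (fun y => -p * y ^ (-p - 1)) (lt_add_one x)
    (fun y hy => (Real.continuousAt_rpow_const _ _
      (Or.inl (hx.trans_le hy.1).ne')).continuousWithinAt)
    (fun y hy => Real.hasDerivAt_rpow_const (Or.inl (hx.trans hy.1).ne'))
  rw [add_sub_cancel_left, div_one] at hc
  have h1 : c ^ (-p - 1) ≤ x ^ (-p - 1) :=
    Real.rpow_le_rpow_of_nonpos hx hc1.le (by linarith)
  have h2 : (x + 1) ^ (-p - 1) ≤ c ^ (-p - 1) :=
    Real.rpow_le_rpow_of_nonpos (hx.trans hc1) hc2.le (by linarith)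
  rw [neg_add']
  constructor <;> nlinarith

lemma mul_sum_rpow_le {p : ℝ} (hp : 0 < p) {n : ℕ} (hn : 0 < n) (m : ℕ) :
    p * ∑ i ∈ Finset.range m, ((n + i + 1 : ℕ) : ℝ) ^ (-(p + 1)) ≤ (n : ℝ) ^ (-p) := by
  have h : p * ∑ i ∈ Finset.range m, ((n + i + 1 : ℕ) : ℝ) ^ (-(p + 1)) ≤
      (n : ℝ) ^ (-p) - ((n + m : ℕ) : ℝ) ^ (-p) := by
    rw [Finset.mul_sum]
    have := Finset.sum_range_sub' (fun i => ((n + i : ℕ) : ℝ) ^ (-p)) m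
    rw [add_zero] at this
    rw [← this]
    refine Finset.sum_le_sum fun i _ => ?_
    have := (rpow_neg_sub_rpow_neg_bounds hp (x := ((n + i : ℕ) : ℝ)) (by positivity)).1
    rw [← add_assoc]
    exact_mod_cast this
  have : 0 ≤ ((n + m : ℕ) : ℝ) ^ (-p) := by positivity
  linarith

lemma le_mul_sum_rpow {p : ℝ} (hp : 0 < p) {n : ℕ} (hn : 0 < n) (m : ℕ) :
    (n : ℝ) ^ (-p) - ((n + m : ℕ) : ℝ) ^ (-p) ≤
      p * ∑ i ∈ Finset.range m, ((n + i : ℕ) : ℝ) ^ (-(p + 1)) := by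
  rw [Finset.mul_sum]
  have := Finset.sum_range_sub' (fun i => ((n + i : ℕ) : ℝ) ^ (-p)) m
  rw [add_zero] at this
  rw [← this]
  refine Finset.sum_le_sum fun i _ => ?_
  have := (rpow_neg_sub_rpow_neg_bounds hp (x := ((n + i : ℕ) : ℝ)) (by positivity)).2
  rw [← add_assoc]
  exact_mod_cast this

lemma rpow_neg_mul_log_rpow_le {p β x y : ℝ} (hp : 0 < p) (hβ : 0 ≤ β) (hx : 1 ≤ x)
    (hxe : Real.exp (2 * β / p) ≤ x) (hxy : x ≤ y) :
    y ^ (-p) * Real.log y ^ (2 * β) ≤ x ^ (-p) * Real.log x ^ (2 * β) := by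
  have hx0 : 0 < x := by linarith
  rcases hβ.eq_or_lt with rfl | hβ
  · simpa using Real.rpow_le_rpow_of_nonpos hx0 hxy (by linarith : -p ≤ 0)
  · have ha : 0 < p / (2 * β) := by positivity
    have key : ∀ z : ℝ, 1 ≤ z → (Real.log z / z ^ (p / (2 * β))) ^ (2 * β) =
        z ^ (-p) * Real.log z ^ (2 * β) := by
      intro z hz
      have hz0 : 0 < z := by linarith
      rw [Real.div_rpow (Real.log_nonneg hz) (by positivity), ← Real.rpow_mul hz0.le,
        div_mul_cancel₀ _ (by positivity), Real.rpow_neg hz0.le, div_eq_inv_mul]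
    rw [← key x hx, ← key y (hx.trans hxy)]
    have hx' : Real.exp (p / (2 * β))⁻¹ ≤ x := by rwa [inv_div]
    refine Real.rpow_le_rpow ?_ ?_ (by positivity)
    · exact div_nonneg (Real.log_nonneg (hx.trans hxy)) (Real.rpow_nonneg (hx0.le.trans hxy) _)
    · exact Real.log_div_self_rpow_antitoneOn ha hx' (hx'.trans hxy) hxy

lemma tendsto_const_mul_rpow_neg_mul_log_rpow {α : ℝ} (hα : 0 < α) (B β : ℝ) :
    Tendsto (fun n : ℕ => B * (n : ℝ) ^ (-α) * Real.log n ^ β) atTop (nhds 0) := by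
  have h := ((isLittleO_log_rpow_rpow_atTop β hα).tendsto_div_nhds_zero.comp
    tendsto_natCast_atTop_atTop).const_mul B
  rw [mul_zero] at h
  refine h.congr fun n => ?_
  simp only [Function.comp_apply]
  rw [Real.rpow_neg (Nat.cast_nonneg n)]
  ring

/-! ### Dominating finite sets -/

lemma exists_finset_card_eq_forall_le {ι : Type*} [Infinite ι] {a : ι → ℝ} (ha : ∀ k, 0 < a k)
    (hfin : ∀ t, 0 < t → {k | t ≤ a k}.Finite) (n : ℕ) :
    ∃ K : Finset ι, K.card = n ∧ ∀ k ∈ K, ∀ l ∉ K, a l ≤ a k := by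
  classical
  induction n with
  | zero => exact ⟨∅, rfl, by simp⟩
  | succ n ih =>
    obtain ⟨K, hKn, hK⟩ := ih
    obtain ⟨k₀, hk₀⟩ := Infinite.exists_notMem_finset K
    have hf : ({k | a k₀ ≤ a k} ∩ {k | k ∉ K}).Finite := (hfin _ (ha k₀)).inter_of_left _
    obtain ⟨m, ⟨hm0, hmK⟩, hm⟩ := Set.exists_max_image _ a hf ⟨k₀, le_refl (a k₀), hk₀⟩
    have hmax : ∀ l ∉ K, a l ≤ a m := fun l hl => by
      rcases le_total (a k₀) (a l) with h | h
      · exact hm l ⟨h, hl⟩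
      · exact h.trans hm0
    refine ⟨insert m K, by rw [Finset.card_insert_of_notMem hmK, hKn], ?_⟩
    intro k hk l hl
    rw [Finset.mem_insert, not_or] at hl
    rcases Finset.mem_insert.mp hk with rfl | hk
    · exact hmax l hl.2
    · exact hK k hk l hl.2

lemma sum_sq_le_sum_sq_of_forall_le {ι : Type*} {a : ι → ℝ} (ha : ∀ k, 0 < a k) {σ : ℕ → ℝ}
    (hσ : ∀ (S : Finset ι) (t : ℝ), 0 ≤ t → S.Nonempty → (∀ k ∈ S, t ≤ a k) → t ≤ σ S.card)
    {K : Finset ι} (hK : ∀ k ∈ K, ∀ l ∉ K, a l ≤ a k) (F : Finset ι) (hF : Disjoint K F) :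
    ∑ k ∈ F, a k ^ 2 ≤ ∑ i ∈ Finset.range F.card, σ (K.card + i + 1) ^ 2 := by
  classical
  induction hc : F.card generalizing F with
  | zero => simp [Finset.card_eq_zero.mp hc]
  | succ m ih =>
    have hne : F.Nonempty := Finset.card_pos.mp (by omega)
    obtain ⟨l, hl, hmin⟩ := Finset.exists_min_image F a hne
    have h1 := ih (F.erase l) (hF.mono_right (Finset.erase_subset _ _))
      (by rw [Finset.card_erase_of_mem hl, hc, Nat.add_sub_cancel])
    have h2 : a l ≤ σ (K.card + m + 1) := by
      have := hσ (K ∪ F) (a l) (ha l).le (hne.inr) fun k hk => by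
        rcases Finset.mem_union.mp hk with hk | hk
        · exact hK k hk l (Finset.disjoint_right.mp hF hl)
        · exact hmin k hk
      rwa [Finset.card_union_of_disjoint hF, hc, ← add_assoc] at this
    rw [← Finset.sum_erase_add _ _ hl, Finset.sum_range_succ]
    have := pow_le_pow_left₀ (ha l).le h2 2
    linarith

/-! ### The diagonal embedding -/

lemma sum_norm_sq_le_norm_sq {d : ℕ} (c : ellTwo d) (F : Finset (ZLat d)) :
    ∑ k ∈ F, ‖c k‖ ^ 2 ≤ ‖c‖ ^ 2 := by
  simpa using lp.sum_rpow_le_norm_rpow (p := 2) (by norm_num) c F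

lemma norm_sq_eq_sum_of_eq_zero {d : ℕ} (c : ellTwo d) (F : Finset (ZLat d))
    (h : ∀ k ∉ F, c k = 0) : ‖c‖ ^ 2 = ∑ k ∈ F, ‖c k‖ ^ 2 := by
  have h1 := lp.norm_rpow_eq_tsum (p := 2) (by norm_num) c
  rw [tsum_eq_sum (s := F) fun k hk => by simp [h k hk]] at h1
  simpa using h1

lemma sum_norm_fourierCoef_sq_le {d : ℕ} (f : Lp ℂ 2 (torusMeasure d)) (F : Finset (ZLat d)) :
    ∑ k ∈ F, ‖fourierCoef (⇑f) k‖ ^ 2 ≤ ‖f‖ ^ 2 := by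
  simpa only [inner_torusCharLp] using
    (orthonormal_torusCharLp d).sum_inner_products_le (x := f) (s := F)

/-- If at least `n` of the numbers `1 / w(k)` are bounded below by `t`, then so is the `n`-th
approximation number of the embedding into `L²`. -/
lemma le_approxNum_of_le_inv {d : ℕ} {w : ZLat d → ℝ} (hw : ∀ k, 0 < w k)
    {T2 : ellTwo d →L[ℂ] Lp ℂ 2 (torusMeasure d)}
    (hT2 : ∀ (c : ellTwo d) (k : ZLat d), fourierCoef (⇑(T2 c)) k = c k / (w k : ℂ))
    (S : Finset (ZLat d)) {t : ℝ} (ht : 0 ≤ t) (hS : ∀ k ∈ S, t ≤ (w k)⁻¹) {n : ℕ} (hn : 0 < n)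
    (hnS : n ≤ S.card) : t ≤ approxNum T2 n := by
  classical
  refine le_approxNum T2 hn fun A hA => ?_
  let L : (S → ℂ) →ₗ[ℂ] ellTwo d :=
    Fintype.linearCombination ℂ fun k : S => (lp.single 2 k.1 1 : ellTwo d)
  have hL : ∀ (a : S → ℂ) (k : ZLat d), L a k = if h : k ∈ S then a ⟨k, h⟩ else 0 := by
    intro a k
    have hsum : L a k = ∑ i : S, a i • (lp.single 2 i.1 1 : ellTwo d) k := by
      change lp.evalCLM ℂ (fun _ : ZLat d => ℂ) 2 k (L a) = _
      rw [Fintype.linearCombination_apply, map_sum]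
      rfl
    rw [hsum]
    split_ifs with h
    · rw [Finset.sum_eq_single ⟨k, h⟩]
      · simp
      · intro l _ hl
        rw [lp.single_apply_ne _ _ _ fun h' => hl (Subtype.ext h'.symm), smul_zero]
      · simp
    · refine Finset.sum_eq_zero fun l _ => ?_
      rw [lp.single_apply_ne _ _ _ fun h' : k = l.1 => h (h' ▸ l.2), smul_zero]
  obtain ⟨a, ha0, ha⟩ : ∃ a : S → ℂ, a ≠ 0 ∧ A (L a) = 0 := by
    by_contra! hcon
    have hinj : Function.Injective ((A : ellTwo d →ₗ[ℂ] Lp ℂ 2 (torusMeasure d)).rangeRestrict ∘ₗ L) := by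
      rw [← LinearMap.ker_eq_bot, LinearMap.ker_eq_bot']
      intro a ha
      by_contra h0
      exact hcon a h0 (congrArg Subtype.val ha)
    have h1 := LinearMap.rank_le_of_injective _ hinj
    rw [rank_fun', Fintype.card_coe] at h1
    exact absurd (h1.trans_lt hA) (by simpa using hnS)
  set c := L a with hc
  have hc0 : ∀ k ∉ S, c k = 0 := fun k hk => by rw [hc, hL, dif_neg hk]
  have hcne : 0 < ‖c‖ := by
    refine norm_pos_iff.mpr fun h => ha0 (funext fun k => ?_)
    have := hL a k
    rw [← hc, h, dif_pos k.2] at this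
    exact this.symm
  have h1 : (t * ‖c‖) ^ 2 ≤ ‖T2 c‖ ^ 2 := by
    refine le_trans ?_ (sum_norm_fourierCoef_sq_le (T2 c) S)
    rw [mul_pow, norm_sq_eq_sum_of_eq_zero c S hc0, Finset.mul_sum]
    refine Finset.sum_le_sum fun k hk => ?_
    rw [hT2, norm_div, Complex.norm_real, Real.norm_of_nonneg (hw k).le, ← mul_pow, div_eq_inv_mul]
    exact pow_le_pow_left₀ (by positivity)
      (mul_le_mul_of_nonneg_right (hS k hk) (norm_nonneg _)) 2
  have h2 : t * ‖c‖ ≤ ‖T2 c‖ := le_of_sq_le_sq h1 (norm_nonneg _)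
  have h3 := (T2 - A).le_opNorm c
  rw [sub_apply, ha, sub_zero] at h3
  exact le_of_mul_le_mul_right (h2.trans h3) hcne

/-- The approximation number `a_{n+1}` of the embedding into `L∞` is bounded by the square root of
the sum of `w(k)⁻²` over the complement of an `n`-element set. -/
lemma approxNum_top_le {d : ℕ} {w : ZLat d → ℝ} (hw : ∀ k, 0 < w k)
    {Ti : ellTwo d →L[ℂ] Lp ℂ ⊤ (torusMeasure d)}
    (hTi : ∀ (c : ellTwo d) (k : ZLat d), fourierCoef (⇑(Ti c)) k = c k / (w k : ℂ))
    (K : Finset (ZLat d)) {M : ℝ} (hM : 0 ≤ M)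
    (hKM : ∀ F, Disjoint K F → ∑ k ∈ F, (w k)⁻¹ ^ 2 ≤ M ^ 2) :
    approxNum Ti (K.card + 1) ≤ M := by
  classical
  let P : ellTwo d →L[ℂ] ellTwo d :=
    ∑ k ∈ K, (lp.singleContinuousLinearMap ℂ (fun _ : ZLat d => ℂ) 2 k) ∘L
      (lp.evalCLM ℂ (fun _ : ZLat d => ℂ) 2 k)
  have hP : ∀ (c : ellTwo d) (k : ZLat d), P c k = if k ∈ K then c k else 0 := by
    intro c k
    have h1 : P c = ∑ l ∈ K, (lp.single 2 l (c l) : ellTwo d) := by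
      simp only [P, sum_apply]
      rfl
    rw [h1]
    simp only [lp.coeFn_sum, Finset.sum_apply, lp.single_apply, Pi.single_apply]
    simp
  have hrank : Module.rank ℂ (LinearMap.range ((Ti ∘L P : ellTwo d →L[ℂ] _) :
      ellTwo d →ₗ[ℂ] Lp ℂ ⊤ (torusMeasure d))) < (K.card + 1 : ℕ) := by
    have hle : LinearMap.range ((Ti ∘L P : ellTwo d →L[ℂ] _) :
        ellTwo d →ₗ[ℂ] Lp ℂ ⊤ (torusMeasure d)) ≤
        Submodule.span ℂ (K.image fun k => Ti (lp.single 2 k 1) : Finset _) := by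
      rintro _ ⟨c, rfl⟩
      have h1 : P c = ∑ l ∈ K, c l • (lp.single 2 l 1 : ellTwo d) := by
        simp only [P, sum_apply]
        refine Finset.sum_congr rfl fun l _ => ?_
        rw [← lp.single_smul, smul_eq_mul, mul_one]
        rfl
      change Ti (P c) ∈ _
      rw [h1, map_sum]
      refine Submodule.sum_mem _ fun l hl => ?_
      rw [map_smul]
      exact Submodule.smul_mem _ _ (Submodule.subset_span (Finset.mem_image_of_mem _ hl))
    refine ((Submodule.rank_mono hle).trans (rank_span_finset_le _)).trans_lt ?_
    exact_mod_cast Nat.lt_succ_of_le Finset.card_image_le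
  refine (approxNum_le Ti _ hrank).trans (ContinuousLinearMap.opNorm_le_bound _ hM fun c => ?_)
  rw [sub_apply, ContinuousLinearMap.comp_apply, ← map_sub]
  suffices h : ∀ᵐ x ∂(torusMeasure d), ‖Ti (c - P c) x‖ ≤ M * ‖c‖ by
    simpa using Lp.norm_le_of_ae_bound (mul_nonneg hM (norm_nonneg _)) h
  refine ae_norm_le_of_sum_fourierCoef_le ((Lp.memLp _).mono_exponent le_top) fun F => ?_
  have hcoef : ∀ k, ‖fourierCoef (⇑(Ti (c - P c))) k‖ = if k ∈ K then 0 else (w k)⁻¹ * ‖c k‖ := by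
    intro k
    rw [hTi, lp.coeFn_sub, Pi.sub_apply, hP, norm_div, Complex.norm_real,
      Real.norm_of_nonneg (hw k).le, div_eq_inv_mul]
    split_ifs <;> simp
  simp only [hcoef]
  rw [Finset.sum_ite, Finset.sum_const_zero, zero_add]
  set F' := F.filter fun k => k ∉ K
  have hdisj : Disjoint K F' := Finset.disjoint_right.mpr fun k hk => (Finset.mem_filter.mp hk).2
  refine le_of_sq_le_sq ?_ (mul_nonneg hM (norm_nonneg _))
  rw [mul_pow]
  refine (Finset.sum_mul_sq_le_sq_mul_sq F' _ _).trans ?_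
  exact mul_le_mul (hKM F' hdisj) (sum_norm_sq_le_norm_sq c F')
    (Finset.sum_nonneg fun _ _ => sq_nonneg _) (sq_nonneg _)

/-- Numbers strictly below the approximation numbers of the embedding into `L²` yield a lower bound
for those of the embedding into `L∞`. -/
lemma sum_sq_le_norm_sub_sq {d : ℕ} {w : ZLat d → ℝ}
    {T2 : ellTwo d →L[ℂ] Lp ℂ 2 (torusMeasure d)}
    (hT2 : ∀ (c : ellTwo d) (k : ZLat d), fourierCoef (⇑(T2 c)) k = c k / (w k : ℂ))
    {Ti : ellTwo d →L[ℂ] Lp ℂ ⊤ (torusMeasure d)}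
    (hTi : ∀ (c : ellTwo d) (k : ZLat d), fourierCoef (⇑(Ti c)) k = c k / (w k : ℂ))
    {n : ℕ} (A : ellTwo d →L[ℂ] Lp ℂ ⊤ (torusMeasure d))
    (hA : Module.rank ℂ (LinearMap.range (A : ellTwo d →ₗ[ℂ] Lp ℂ ⊤ (torusMeasure d))) < n)
    {θ : ℕ → ℝ} (hθ : ∀ i, 0 ≤ θ i) (hθn : ∀ i, θ i < approxNum T2 (n + i)) (p : ℕ) :
    ∑ i ∈ Finset.range p, θ i ^ 2 ≤ ‖Ti - A‖ ^ 2 := by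
  obtain ⟨f, hfo, hf⟩ := exists_orthonormal_mem_ker T2 A hA hθ hθn p
  have hae : ∀ c, ⇑(T2 c) =ᵐ[torusMeasure d] ⇑(Ti c) := fun c =>
    ae_eq_of_fourierCoef_eq (Lp.memLp _) ((Lp.memLp _).mono_exponent le_top) fun k => by
      rw [hT2, hTi]
  have hnorm : ∀ i, ‖T2 (f i)‖ ^ 2 = ∫ x, ‖T2 (f i) x‖ ^ 2 ∂(torusMeasure d) := by
    intro i
    have h1 := L2.inner_def (𝕜 := ℂ) (T2 (f i)) (T2 (f i))
    simp only [inner_self_eq_norm_sq_to_K] at h1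
    have h2 : ((‖T2 (f i)‖ ^ 2 : ℝ) : ℂ) =
        ((∫ x, ‖T2 (f i) x‖ ^ 2 ∂(torusMeasure d) : ℝ) : ℂ) := by
      rw [← integral_complex_ofReal]
      push_cast
      exact h1
    exact_mod_cast h2
  have hint : ∀ i, Integrable (fun x => ‖T2 (f i) x‖ ^ 2) (torusMeasure d) := fun i =>
    (Lp.memLp (T2 (f i))).integrable_norm_pow (by norm_num)
  rw [← Fin.sum_univ_eq_sum_range (fun i => θ i ^ 2)]
  calc ∑ i : Fin p, θ i ^ 2 ≤ ∑ i, ‖T2 (f i)‖ ^ 2 :=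
        Finset.sum_le_sum fun i _ => pow_le_pow_left₀ (hθ i) (hf i).2 2
    _ = ∫ x, ∑ i, ‖T2 (f i) x‖ ^ 2 ∂(torusMeasure d) := by
        rw [integral_finsetSum _ fun i _ => hint i]
        exact Finset.sum_congr rfl fun i _ => hnorm i
    _ ≤ ∫ _, ‖Ti - A‖ ^ 2 ∂(torusMeasure d) := by
        refine integral_mono_ae (integrable_finsetSum _ fun i _ => hint i)
          (integrable_const _) ?_
        have hall : ∀ᵐ x ∂(torusMeasure d), ∀ i, T2 (f i) x = (Ti - A) (f i) x :=
          ae_all_iff.mpr fun i => by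
            rw [sub_apply, (hf i).1, sub_zero]
            exact hae (f i)
        filter_upwards [ae_sum_sq_le_of_orthonormal (Ti - A) hfo, hall] with x hx hx'
        simpa only [hx'] using hx
    _ = ‖Ti - A‖ ^ 2 := by simp

/-- If the approximation numbers of the embedding into `L²` tend to zero, then so do the numbers
`1 / w(k)`. -/
lemma finite_setOf_le_inv {d : ℕ} {w : ZLat d → ℝ} (hw : ∀ k, 0 < w k)
    {T2 : ellTwo d →L[ℂ] Lp ℂ 2 (torusMeasure d)}
    (hT2 : ∀ (c : ellTwo d) (k : ZLat d), fourierCoef (⇑(T2 c)) k = c k / (w k : ℂ))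
    {b : ℕ → ℝ} (hb : Tendsto b atTop (nhds 0)) {N : ℕ}
    (hup : ∀ n : ℕ, N ≤ n → approxNum T2 n ≤ b n) {t : ℝ} (ht : 0 < t) :
    {k | t ≤ (w k)⁻¹}.Finite := by
  by_contra hinf
  obtain ⟨n, hnt, hnN⟩ := ((hb.eventually_lt_const ht).and (eventually_ge_atTop (N + 1))).exists
  obtain ⟨S, hS, hSn⟩ := Set.Infinite.exists_subset_card_eq hinf n
  have := le_approxNum_of_le_inv hw hT2 S ht.le (fun k hk => hS hk) (by omega : 0 < n) hSn.ge
  linarith [hup n (by omega)]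

/-- Proposition 4 of Cobos–Kühn–Sickel. Suppose the approximation
numbers `σ_n = a_n(I_d : F_d(w) → L₂(𝕋^d))` satisfy
`A n^{-α} (ln n)^β ≤ σ_n ≤ B n^{-α} (ln n)^β` for all `n ≥ N`, where `α > 1/2`,
`β ≥ 0`, `0 < A ≤ B` and `N ∈ ℕ`.  Then
(i) `a_{n+1}(I_d : F_d(w) → L_∞) ≤ B √(2/(2α-1)) n^{1/2-α} (ln n)^β` for all
`n ≥ max(N, e^{4β/(2α-1)})`, and
(ii) `a_n(I_d : F_d(w) → L_∞) ≥ A √(1/(4α-2)) n^{1/2-α} (ln n)^β` for all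
`n ≥ max(N, 2)`. -/
theorem statement6 (d : ℕ) (hd : 0 < d) (w : ZLat d → ℝ) (hw : ∀ k, 0 < w k)
    (α β : ℝ) (hα : 1 / 2 < α) (hβ : 0 ≤ β)
    (A B : ℝ) (hA : 0 < A) (hAB : A ≤ B) (N : ℕ) (hN : 1 ≤ N)
    (T2 : ellTwo d →L[ℂ] Lp ℂ 2 (torusMeasure d))
    (hT2 : ∀ (c : ellTwo d) (k : ZLat d), fourierCoef (⇑(T2 c)) k = c k / (w k : ℂ))
    (Ti : ellTwo d →L[ℂ] Lp ℂ ⊤ (torusMeasure d))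
    (hTi : ∀ (c : ellTwo d) (k : ZLat d), fourierCoef (⇑(Ti c)) k = c k / (w k : ℂ))
    (hlow : ∀ n : ℕ, N ≤ n →
      A * (n : ℝ) ^ (-α) * Real.log n ^ β ≤ approxNum T2 n)
    (hup : ∀ n : ℕ, N ≤ n →
      approxNum T2 n ≤ B * (n : ℝ) ^ (-α) * Real.log n ^ β) :
    (∀ n : ℕ, N ≤ n → Real.exp (4 * β / (2 * α - 1)) ≤ (n : ℝ) →
      approxNum Ti (n + 1) ≤
        B * Real.sqrt (2 / (2 * α - 1)) * (n : ℝ) ^ ((1 : ℝ) / 2 - α) * Real.log n ^ β) ∧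
    (∀ n : ℕ, N ≤ n → 2 ≤ n →
      A * Real.sqrt (1 / (4 * α - 2)) * (n : ℝ) ^ ((1 : ℝ) / 2 - α) * Real.log n ^ β ≤
        approxNum Ti n) := by
  constructor
  · intro n hNn hn
    have hn0 : 0 < n := hN.trans hNn
    have hn1 : (1 : ℝ) ≤ n := by exact_mod_cast hn0
    have hnpos : (0 : ℝ) < n := by linarith
    have hα' : 0 < α - 1 / 2 := by linarith
    have hB : 0 < B := hA.trans_le hAB
    have : NeZero d := ⟨hd.ne'⟩
    obtain ⟨K, hKn, hK⟩ := exists_finset_card_eq_forall_le (fun k => inv_pos.mpr (hw k))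
      (fun t ht => finite_setOf_le_inv hw hT2
        (tendsto_const_mul_rpow_neg_mul_log_rpow (by linarith : 0 < α) B β) hup ht) n
    subst hKn
    have hlog : 0 ≤ Real.log K.card := Real.log_nonneg hn1
    refine approxNum_top_le hw hTi K (by positivity) fun F hF => ?_
    refine (sum_sq_le_sum_sq_of_forall_le (fun k => inv_pos.mpr (hw k)) (σ := approxNum T2)
      (fun S t ht hS h => le_approxNum_of_le_inv hw hT2 S ht h (Finset.card_pos.mpr hS) le_rfl)
      hK F hF).trans ?_
    have hM : (B * Real.sqrt (2 / (2 * α - 1)) * (K.card : ℝ) ^ ((1 : ℝ) / 2 - α) *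
        Real.log K.card ^ β) ^ 2 = B ^ 2 * ((K.card : ℝ) ^ (-(α - 1 / 2)) *
          Real.log K.card ^ (2 * β)) * ((K.card : ℝ) ^ (-(α - 1 / 2)) / (α - 1 / 2)) := by
      have h1 : Real.log K.card ^ (2 * β) = (Real.log K.card ^ β) ^ 2 := by
        rw [mul_comm, Real.rpow_mul hlog, Real.rpow_two]
      have h2 : (1 : ℝ) / 2 - α = -(α - 1 / 2) := by ring
      have h3 : 2 / (2 * α - 1) = 1 / (α - 1 / 2) := by
        rw [div_eq_div_iff (by linarith) (by linarith)]; ring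
      rw [mul_pow, mul_pow, mul_pow, Real.sq_sqrt (by rw [h3]; positivity), h1, h2, h3]
      ring
    rw [hM]
    have hsum : ∑ i ∈ Finset.range F.card, ((K.card + i + 1 : ℕ) : ℝ) ^ (-(α - 1 / 2 + 1)) ≤
        (K.card : ℝ) ^ (-(α - 1 / 2)) / (α - 1 / 2) := by
      rw [le_div_iff₀' hα']
      exact mul_sum_rpow_le hα' hn0 _
    refine le_trans ?_ (mul_le_mul_of_nonneg_left hsum (by positivity))
    rw [Finset.mul_sum]
    refine Finset.sum_le_sum fun i _ => ?_
    set j : ℕ := K.card + i + 1 with hj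
    have hjn : (K.card : ℝ) ≤ j := by rw [hj]; push_cast; linarith [(Nat.cast_nonneg i : (0:ℝ) ≤ i)]
    have hj1 : (1 : ℝ) ≤ j := hn1.trans hjn
    have hj0 : (0 : ℝ) < j := by linarith
    have hjlog : 0 ≤ Real.log j := Real.log_nonneg hj1
    have hσ0 : 0 ≤ approxNum T2 j := le_approxNum T2 (by omega) fun A _ => norm_nonneg _
    have hexp : Real.exp (2 * β / (α - 1 / 2)) ≤ K.card := by
      convert hn using 2
      rw [div_eq_div_iff (by linarith) (by linarith)]; ring
    have hmono := rpow_neg_mul_log_rpow_le hα' hβ hn1 hexp hjn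
    calc approxNum T2 j ^ 2 ≤ (B * (j : ℝ) ^ (-α) * Real.log j ^ β) ^ 2 :=
          pow_le_pow_left₀ hσ0 (hup j (by omega)) 2
      _ = B ^ 2 * ((j : ℝ) ^ (-(α - 1 / 2)) * Real.log j ^ (2 * β)) *
            (j : ℝ) ^ (-(α - 1 / 2 + 1)) := by
          have h1 : Real.log j ^ (2 * β) = (Real.log j ^ β) ^ 2 := by
            rw [mul_comm, Real.rpow_mul hjlog, Real.rpow_two]
          have h2 : ((j : ℝ) ^ (-α)) ^ 2 =
              (j : ℝ) ^ (-(α - 1 / 2)) * (j : ℝ) ^ (-(α - 1 / 2 + 1)) := by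
            rw [← Real.rpow_add hj0, ← Real.rpow_two, ← Real.rpow_mul hj0.le]
            congr 1; ring
          rw [mul_pow, mul_pow, h1, h2]
          ring
      _ ≤ _ := by
          refine mul_le_mul_of_nonneg_right ?_ (by positivity)
          exact mul_le_mul_of_nonneg_left hmono (by positivity)
  · intro n hNn hn
    have hn1 : (1 : ℝ) < n := by exact_mod_cast hn
    have hlog : 0 < Real.log n := Real.log_pos hn1
    have hα' : 0 < 2 * α - 1 := by linarith
    refine le_approxNum Ti (by omega) fun S hS => ?_
    refine le_of_sq_le_sq ?_ (norm_nonneg _)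
    have hθn : ∀ i : ℕ, A / Real.sqrt 2 * ((n + i : ℕ) : ℝ) ^ (-α) * Real.log n ^ β <
        approxNum T2 (n + i) := by
      intro i
      have hni : (n : ℝ) ≤ (n + i : ℕ) := by exact_mod_cast Nat.le_add_right n i
      have hni0 : (0 : ℝ) < (n + i : ℕ) := by linarith
      refine lt_of_lt_of_le ?_ (hlow (n + i) (by omega))
      refine mul_lt_mul ?_ (Real.rpow_le_rpow hlog.le (Real.log_le_log (by linarith) hni) hβ)
        (by positivity) (by positivity)
      refine mul_lt_mul_of_pos_right ?_ (by positivity)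
      exact div_lt_self hA (by rw [Real.lt_sqrt] <;> norm_num)
    have hmain := sum_sq_le_norm_sub_sq hT2 hTi S hS (fun i => by positivity) hθn
    have hbound : ∀ p : ℕ, A ^ 2 / 2 * Real.log n ^ (2 * β) / (2 * α - 1) *
        ((n : ℝ) ^ (-(2 * α - 1)) - ((n + p : ℕ) : ℝ) ^ (-(2 * α - 1))) ≤ ‖Ti - S‖ ^ 2 := by
      intro p
      refine le_trans ?_ (hmain p)
      have h1 : Real.log n ^ (2 * β) = (Real.log n ^ β) ^ 2 := by
        rw [mul_comm, Real.rpow_mul hlog.le, Real.rpow_two]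
      have h2 : ∀ i : ℕ, (A / Real.sqrt 2 * ((n + i : ℕ) : ℝ) ^ (-α) * Real.log n ^ β) ^ 2 =
          A ^ 2 / 2 * Real.log n ^ (2 * β) * ((n + i : ℕ) : ℝ) ^ (-(2 * α - 1 + 1)) := by
        intro i
        have h3 : (((n + i : ℕ) : ℝ) ^ (-α)) ^ 2 = ((n + i : ℕ) : ℝ) ^ (-(2 * α - 1 + 1)) := by
          rw [← Real.rpow_two, ← Real.rpow_mul (Nat.cast_nonneg _)]
          congr 1; ring
        rw [mul_pow, mul_pow, div_pow, Real.sq_sqrt (by norm_num), h1, h3]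
        ring
      simp only [h2]
      rw [← Finset.mul_sum, div_mul_eq_mul_div, mul_div_assoc]
      refine mul_le_mul_of_nonneg_left ?_ (by positivity)
      rw [div_le_iff₀' hα']
      exact le_mul_sum_rpow hα' (by omega) p
    have hlim : Tendsto (fun p : ℕ => A ^ 2 / 2 * Real.log n ^ (2 * β) / (2 * α - 1) *
        ((n : ℝ) ^ (-(2 * α - 1)) - ((n + p : ℕ) : ℝ) ^ (-(2 * α - 1)))) atTop
        (nhds (A ^ 2 / 2 * Real.log n ^ (2 * β) / (2 * α - 1) *
          ((n : ℝ) ^ (-(2 * α - 1)) - 0))) := by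
      refine (Tendsto.sub tendsto_const_nhds ?_).const_mul _
      exact (tendsto_rpow_neg_atTop hα').comp (tendsto_natCast_atTop_atTop.comp
        (tendsto_atTop_mono (fun p => Nat.le_add_left p n) tendsto_id))
    refine le_trans (le_of_eq ?_) (le_of_tendsto' hlim hbound)
    have h1 : Real.log n ^ (2 * β) = (Real.log n ^ β) ^ 2 := by
      rw [mul_comm, Real.rpow_mul hlog.le, Real.rpow_two]
    have h2 : ((n : ℝ) ^ ((1 : ℝ) / 2 - α)) ^ 2 = (n : ℝ) ^ (-(2 * α - 1)) := by
      rw [← Real.rpow_two, ← Real.rpow_mul (Nat.cast_nonneg _)]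
      congr 1; ring
    have h3 : 1 / (4 * α - 2) = 1 / 2 / (2 * α - 1) := by
      rw [div_div]; congr 1; ring
    rw [mul_pow, mul_pow, mul_pow, Real.sq_sqrt (by rw [h3]; positivity), h1, h2, h3]
    ring
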